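/- arXiv:1505.01246 — 8 statements merged into one kernel-verified Lean document; each statement's English description precedes it below -/
import Mathlib

section
/- Delayed intermittent averaging with leaders (Proposition 1, leader case): Let N be a finite set of n ≥ 1 agents, m ≥ 1, L ⊆ N a nonempty set of leaders, v_d ∈ ℝ^m, and h* ∈ ℕ. Let E be an edge relation on N such that: E i i holds for every i ∈ N; E j i holds for all i, j ∈ L; E j i fails whenever i ∈ L and j ∉ L; and E is rooted at some r ∈ L. Let N̄ : ℕ × N → Finset N assign neighbor sets with i ∈ N̄(σ, i) and N̄(σ, i) ⊆ {j : E j i} for all σ and i, and let τ : ℕ × N × N → ℕ be delays with τ(σ, i, i) = 0 and τ(σ, i, j) ≤ min(σ, h*) for all σ, i, j. Let v̂ : ℕ × N → ℝ^m satisfy v̂(σ, i) = v_d for all σ ∈ ℕ and all i ∈ L, and v̂(σ+1, i) = (1 / |N̄(σ, i)|) · Σ_{j ∈ N̄(σ, i)} v̂(σ − τ(σ, i, j), j) for all σ ∈ ℕ and all i ∉ L. Assume the recurrence condition: for every σ ∈ ℕ and every edge (j, i) of E with i ∉ L, there exists σ' ∈ {σ, σ+1, …, σ + h*} with j ∈ N̄(σ',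 i). Then v̂(σ, i) → v_d as σ → ∞ for every i ∈ N. -/
open Filter

theorem Finset.average_le_sub_div {ι : Type*} {s : Finset ι} {f : ι → ℝ} {B n : ℝ} {j : ι}
    (hj : j ∈ s) (hf : ∀ k ∈ s, f k ≤ B) (hn : (s.card : ℝ) ≤ n) :
    (s.card : ℝ)⁻¹ * ∑ k ∈ s, f k ≤ B - (B - f j) / n := by
  have hc : (0 : ℝ) < s.card := by exact_mod_cast Finset.card_pos.2 ⟨j, hj⟩
  have hsum : B - f j ≤ ∑ k ∈ s, (B - f k) :=
    Finset.single_le_sum (fun k hk => sub_nonneg.2 (hf k hk)) hj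
  rw [Finset.sum_sub_distrib, Finset.sum_const, nsmul_eq_mul] at hsum
  have hdiv : (B - f j) / n ≤ (B - f j) / s.card :=
    div_le_div_of_nonneg_left (sub_nonneg.2 (hf j hj)) hc hn
  have havg : (s.card : ℝ)⁻¹ * ∑ k ∈ s, f k ≤ B - (B - f j) / s.card := by
    rw [inv_mul_eq_div, div_le_iff₀ hc, sub_mul, div_mul_cancel₀ _ hc.ne']
    linarith
  linarith

/-- A bound on a neighbor that is strictly better than the common bound `B` propagates, weakened
by a fixed factor, along an edge that is used at least once in every window of length `h + 1`. -/
theorem eventually_le_of_recurrent_edge {N : Type*} [Fintype N] {Nbar : ℕ → N → Finset N}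
    {τ : ℕ → N → N → ℕ} {x : ℕ → N → ℝ} {h : ℕ} {i j : N}
    (hmem : ∀ σ, i ∈ Nbar σ i) (hτself : ∀ σ, τ σ i i = 0) (hτle : ∀ σ k, τ σ i k ≤ h)
    (havg : ∀ σ, x (σ + 1) i ≤
      ((Nbar σ i).card : ℝ)⁻¹ * ∑ k ∈ Nbar σ i, x (σ - τ σ i k) k)
    (hrec : ∀ σ, ∃ σ' ∈ Finset.Icc σ (σ + h), j ∈ Nbar σ' i)
    {B b : ℝ} (hbB : b ≤ B) (hB : ∀ᶠ σ in atTop, ∀ k, x σ k ≤ B)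
    (hb : ∀ᶠ σ in atTop, x σ j ≤ b) :
    ∀ᶠ σ in atTop, x σ i ≤ B - (B - b) / (Fintype.card N : ℝ) ^ (h + 1) := by
  obtain ⟨S, hS⟩ := eventually_atTop.1 (hB.and hb)
  set n : ℝ := (Fintype.card N : ℝ) with hn_def
  have hn : (1 : ℝ) ≤ n := by
    have : 0 < Fintype.card N := Fintype.card_pos_iff.2 ⟨i⟩
    rw [hn_def]
    exact_mod_cast this
  have hstep : ∀ σ, S + h ≤ σ → ∀ k ∈ Nbar σ i,
      x (σ + 1) i ≤ B - (B - x (σ - τ σ i k) k) / n := fun σ hσ k hk =>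
    (havg σ).trans <| Finset.average_le_sub_div (f := fun k => x (σ - τ σ i k) k) hk
      (fun l _ => (hS _ (by have := hτle σ l; omega)).1 l)
      (by rw [hn_def]; exact_mod_cast Finset.card_le_univ _)
  refine eventually_atTop.2 ⟨S + 2 * h + 1, fun t ht => ?_⟩
  obtain ⟨σ, hσ, hj⟩ := hrec (t - h - 1)
  rw [Finset.mem_Icc] at hσ
  have hdecay : ∀ k, x (σ + 1 + k) i ≤ B - (B - b) / n ^ (k + 1) := by
    intro k
    induction k with
    | zero =>
      have h1 := hstep σ (by omega) j hj
      have h2 := (hS (σ - τ σ i j) (by have := hτle σ j; omega)).2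
      have h3 : (B - b) / n ≤ (B - x (σ - τ σ i j) j) / n := by gcongr
      simp only [add_zero, zero_add, pow_one]
      linarith
    | succ k ih =>
      have h1 := hstep (σ + 1 + k) (by omega) i (hmem _)
      rw [hτself, Nat.sub_zero] at h1
      have h2 : (B - b) / n ^ (k + 1) / n ≤ (B - x (σ + 1 + k) i) / n := by
        gcongr
        linarith
      rw [div_div, ← pow_succ] at h2
      rw [← add_assoc]
      linarith
  have h1 := hdecay (t - σ - 1)
  rw [show σ + 1 + (t - σ - 1) = t by omega] at h1
  have h2 : (B - b) / n ^ (h + 1) ≤ (B - b) / n ^ (t - σ - 1 + 1) :=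
    div_le_div_of_nonneg_left (sub_nonneg.2 hbB) (by positivity)
      (pow_le_pow_right₀ hn (by omega))
  linarith

/-- If eventual uniform bounds on finitely many nonnegative sequences improve, at each index,
by a factor less than one, then all the sequences tend to zero. -/
theorem tendsto_zero_of_eventually_le_mul {N : Type*} [Fintype N] [Nonempty N]
    {x : ℕ → N → ℝ} (hx : ∀ σ i, 0 ≤ x σ i) {B : ℝ} (hB : ∀ σ i, x σ i ≤ B)
    (hcontr : ∀ i, ∃ ρ < (1 : ℝ), ∀ C, 0 ≤ C → (∀ᶠ σ in atTop, ∀ k, x σ k ≤ C) →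
      ∀ᶠ σ in atTop, x σ i ≤ ρ * C) (i : N) :
    Tendsto (fun σ => x σ i) atTop (nhds 0) := by
  choose ρ hρ hcontr using hcontr
  obtain ⟨i₀, hi₀⟩ := Finite.exists_max ρ
  set q := max (ρ i₀) 0
  have hq0 : 0 ≤ q := le_max_right _ _
  have hq1 : q < 1 := max_lt (hρ i₀) one_pos
  have hB0 : 0 ≤ B := (hx 0 i).trans (hB 0 i)
  have hpow : ∀ k : ℕ, ∀ᶠ σ in atTop, ∀ i, x σ i ≤ q ^ k * B := by
    intro k
    induction k with
    | zero => exact Eventually.of_forall fun σ i => by simpa using hB σ i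
    | succ k ih =>
      refine eventually_all.2 fun i => ?_
      filter_upwards [hcontr i _ (by positivity) ih] with σ hσ
      refine hσ.trans ?_
      rw [pow_succ', mul_assoc]
      exact mul_le_mul_of_nonneg_right ((hi₀ i).trans (le_max_left _ _)) (by positivity)
  have hlim : Tendsto (fun k : ℕ => q ^ k * B) atTop (nhds 0) := by
    simpa using (tendsto_pow_atTop_nhds_zero_of_lt_one hq0 hq1).mul_const B
  refine tendsto_order.2 ⟨fun a ha => Eventually.of_forall fun σ => ha.trans_le (hx σ i),
    fun a ha => ?_⟩
  obtain ⟨k, hk⟩ := (hlim.eventually_lt_const ha).exists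
  filter_upwards [hpow k] with σ hσ
  exact (hσ i).trans_lt hk

/-- Delayed intermittent averaging with leaders (Proposition 1, leader case):
leaders hold the constant desired velocity `v_d`, followers average the most
recent delayed estimates of their neighbors; if the interconnection graph is
rooted at a leader and every edge delivers new information at least once every
`h* + 1` sampling instants, then every estimate converges to `v_d`. -/
theorem delayed_intermittent_averaging_with_leaders
    {N : Type*} [Fintype N] [DecidableEq N] [Nonempty N]
    (m : ℕ) (hm : 1 ≤ m)
    (L : Set N) (hL : L.Nonempty)
    (vd : EuclideanSpace ℝ (Fin m))
    (hstar : ℕ)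
    (E : N → N → Prop)
    (hself : ∀ i, E i i)
    (hLL : ∀ i ∈ L, ∀ j ∈ L, E j i)
    (hLnoin : ∀ i ∈ L, ∀ j ∉ L, ¬ E j i)
    (r : N) (hr : r ∈ L)
    (hrooted : ∀ i, Relation.ReflTransGen E r i)
    (Nbar : ℕ → N → Finset N)
    (hmem : ∀ σ i, i ∈ Nbar σ i)
    (hsub : ∀ σ i, ∀ j ∈ Nbar σ i, E j i)
    (τ : ℕ → N → N → ℕ)
    (hτself : ∀ σ i, τ σ i i = 0)
    (hτle : ∀ σ i j, τ σ i j ≤ min σ hstar)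
    (vhat : ℕ → N → EuclideanSpace ℝ (Fin m))
    (hleader : ∀ σ : ℕ, ∀ i ∈ L, vhat σ i = vd)
    (hupdate : ∀ σ : ℕ, ∀ i, i ∉ L →
      vhat (σ + 1) i =
        ((Nbar σ i).card : ℝ)⁻¹ • ∑ j ∈ Nbar σ i, vhat (σ - τ σ i j) j)
    (hrec : ∀ σ : ℕ, ∀ i, i ∉ L → ∀ j, E j i →
      ∃ σ' ∈ Finset.Icc σ (σ + hstar), j ∈ Nbar σ' i) :
    ∀ i, Tendsto (fun σ => vhat σ i) atTop (nhds vd) := by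
  set x : ℕ → N → ℝ := fun σ i => ‖vhat σ i - vd‖ with hx_def
  have hx0 : ∀ σ i, 0 ≤ x σ i := fun σ i => norm_nonneg _
  have hxL : ∀ σ, ∀ i ∈ L, x σ i = 0 := fun σ i hi => by simp [hx_def, hleader σ i hi]
  have havg : ∀ i, i ∉ L → ∀ σ, x (σ + 1) i ≤
      ((Nbar σ i).card : ℝ)⁻¹ * ∑ k ∈ Nbar σ i, x (σ - τ σ i k) k := by
    intro i hi σ
    have hc : ((Nbar σ i).card : ℝ) ≠ 0 := by
      exact_mod_cast (Finset.card_pos.2 ⟨i, hmem σ i⟩).ne'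
    have heq : vhat (σ + 1) i - vd =
        ((Nbar σ i).card : ℝ)⁻¹ • ∑ k ∈ Nbar σ i, (vhat (σ - τ σ i k) k - vd) := by
      rw [hupdate σ i hi, Finset.sum_sub_distrib, Finset.sum_const, smul_sub,
        ← Nat.cast_smul_eq_nsmul ℝ, inv_smul_smul₀ hc]
    simp only [hx_def]
    rw [heq, norm_smul, norm_inv, RCLike.norm_natCast]
    gcongr
    exact norm_sum_le _ _
  have hbdd : ∀ σ i, x σ i ≤ ∑ k, x 0 k := by
    intro σ
    induction σ using Nat.strong_induction_on with
    | _ σ ih =>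
      intro i
      rcases σ with _ | σ
      · exact Finset.single_le_sum (fun k _ => hx0 0 k) (Finset.mem_univ i)
      by_cases hi : i ∈ L
      · rw [hxL _ i hi]
        exact Finset.sum_nonneg fun k _ => hx0 0 k
      · have hle : ∀ k, x (σ - τ σ i k) k ≤ ∑ k, x 0 k := fun k => ih _ (by omega) k
        have h1 := Finset.average_le_sub_div (f := fun k => x (σ - τ σ i k) k) (hmem σ i)
          (fun k _ => hle k) le_rfl
        have h2 := div_nonneg (sub_nonneg.2 (hle i)) (Nat.cast_nonneg (α := ℝ) (Nbar σ i).card)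
        linarith [havg i hi σ]
  have hcontr : ∀ i, ∃ ρ < (1 : ℝ), ∀ C, 0 ≤ C → (∀ᶠ σ in atTop, ∀ k, x σ k ≤ C) →
      ∀ᶠ σ in atTop, x σ i ≤ ρ * C := by
    have hlead : ∀ i ∈ L, ∃ ρ < (1 : ℝ), ∀ C, 0 ≤ C → (∀ᶠ σ in atTop, ∀ k, x σ k ≤ C) →
        ∀ᶠ σ in atTop, x σ i ≤ ρ * C := fun i hi =>
      ⟨0, one_pos, fun C _ _ => Eventually.of_forall fun σ => by simp [hxL σ i hi]⟩
    intro i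
    induction hrooted i with
    | refl => exact hlead r hr
    | @tail j i _ hji ih =>
      by_cases hi : i ∈ L
      · exact hlead i hi
      obtain ⟨ρ, hρ, hj⟩ := ih
      refine ⟨1 - (1 - ρ) / (Fintype.card N : ℝ) ^ (hstar + 1), ?_, fun C hC hev => ?_⟩
      · have hn : (0 : ℝ) < Fintype.card N := by exact_mod_cast Fintype.card_pos
        exact sub_lt_self _ (div_pos (sub_pos.2 hρ) (by positivity))
      · have := eventually_le_of_recurrent_edge (fun σ => hmem σ i) (fun σ => hτself σ i)
          (fun σ k => (hτle σ i k).trans (min_le_right _ _)) (havg i hi)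
          (fun σ => hrec σ i hi j hji) (mul_le_of_le_one_left hC hρ.le) hev (hj C hC hev)
        filter_upwards [this] with σ hσ
        exact hσ.trans_eq (by ring)
  intro i
  exact tendsto_iff_norm_sub_tendsto_zero.2
    (tendsto_zero_of_eventually_le_mul hx0 hbdd hcontr i)
end

section
/- Delayed intermittent averaging without leaders (Proposition 1, leaderless case): Let N be a finite set of n ≥ 1 agents, m ≥ 1, and h* ∈ ℕ. Let E be an edge relation on N such that E i i holds for every i ∈ N and E is rooted at some r ∈ N. Let N̄ : ℕ × N → Finset N assign neighbor sets with i ∈ N̄(σ, i) and N̄(σ, i) ⊆ {j : E j i} for all σ and i, and let τ : ℕ × N × N → ℕ be delays with τ(σ, i, i) = 0 and τ(σ, i, j) ≤ min(σ, h*) for all σ, i, j. Let v̂ : ℕ × N → ℝ^m satisfy v̂(σ+1, i) = (1 / |N̄(σ, i)|) · Σ_{j ∈ N̄(σ, i)} v̂(σ − τ(σ, i, j), j) for all σ ∈ ℕ and all i ∈ N. Assume the recurrence condition: for every σ ∈ ℕ and every edge (j, i) of E, there exists σ' ∈ {σ, σ+1, …, σ + h*} with j ∈ N̄(σ', i). Then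 there exists v_c ∈ ℝ^m such that v̂(σ, i) → v_c as σ → ∞ for every i ∈ N. -/
open Filter

/-- `x` evolves by averaging the `τ`-delayed values over the neighbor sets `Nbar`. -/
def IsDelayedAverage {N : Type*} (Nbar : ℕ → N → Finset N) (τ : ℕ → N → N → ℕ)
    (x : ℕ → N → ℝ) : Prop :=
  ∀ σ i, x (σ + 1) i = ((Nbar σ i).card : ℝ)⁻¹ * ∑ j ∈ Nbar σ i, x (σ - τ σ i j) j

namespace IsDelayedAverage

variable {N : Type*} {Nbar : ℕ → N → Finset N} {τ : ℕ → N → N → ℕ} {x : ℕ → N → ℝ}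

lemma neg (hx : IsDelayedAverage Nbar τ x) : IsDelayedAverage Nbar τ (fun s i => -x s i) := by
  intro σ i
  simp [hx σ i]

lemma inv_card_mul_sub_le [Fintype N] (hx : IsDelayedAverage Nbar τ x) {a : ℝ} {t : ℕ} {i j : N}
    (ha : ∀ k ∈ Nbar t i, a ≤ x (t - τ t i k) k) (hj : j ∈ Nbar t i) :
    (Fintype.card N : ℝ)⁻¹ * (x (t - τ t i j) j - a) ≤ x (t + 1) i - a := by
  have hpos : (0 : ℝ) < (Nbar t i).card := by
    exact_mod_cast Finset.card_pos.2 ⟨j, hj⟩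
  have hle : ((Nbar t i).card : ℝ) ≤ Fintype.card N := by
    exact_mod_cast Finset.card_le_univ _
  have hsum : x (t + 1) i - a =
      ((Nbar t i).card : ℝ)⁻¹ * ∑ k ∈ Nbar t i, (x (t - τ t i k) k - a) := by
    rw [hx t i, Finset.sum_sub_distrib, Finset.sum_const, nsmul_eq_mul, mul_sub,
      inv_mul_cancel_left₀ hpos.ne']
  have hnonneg : ∀ k ∈ Nbar t i, 0 ≤ x (t - τ t i k) k - a := fun k hk => sub_nonneg.2 (ha k hk)
  rw [hsum]
  exact mul_le_mul (inv_anti₀ hpos hle)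
    (Finset.single_le_sum (f := fun k => x (t - τ t i k) k - a) hnonneg hj) (hnonneg j hj)
    (inv_nonneg.2 hpos.le)

/-- A lower bound on a window of `h + 1` instants persists forever. -/
lemma le_of_le_on_window [Fintype N] (hx : IsDelayedAverage Nbar τ x)
    (hmem : ∀ σ i, i ∈ Nbar σ i) {h : ℕ} (hτ : ∀ σ i j, τ σ i j ≤ h) {a : ℝ} {σ : ℕ}
    (ha : ∀ s, σ ≤ s → s ≤ σ + h → ∀ i, a ≤ x s i) :
    ∀ s, σ ≤ s → ∀ i, a ≤ x s i := by
  intro s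
  induction s using Nat.strong_induction_on with
  | _ s ih =>
    intro hs i
    rcases le_or_gt s (σ + h) with hsh | hsh
    · exact ha s hs hsh i
    · obtain ⟨t, rfl⟩ : ∃ t, s = t + 1 := ⟨s - 1, by omega⟩
      have hb : ∀ k ∈ Nbar t i, a ≤ x (t - τ t i k) k := fun k _ => by
        have := hτ t i k
        exact ih _ (by omega) (by omega) k
      have h1 := hx.inv_card_mul_sub_le hb (hmem t i)
      have h2 : 0 ≤ (Fintype.card N : ℝ)⁻¹ * (x (t - τ t i i) i - a) :=
        mul_nonneg (by positivity) (sub_nonneg.2 (hb i (hmem t i)))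
      linarith

variable [Fintype N] [Nonempty N] {E : N → N → Prop} {r : N} {h : ℕ}

/-- The influence of the root reaches a fixed agent within a bounded time, uniformly in the
trajectory and the starting instant. -/
lemma exists_delay_root_influence (hmem : ∀ σ i, i ∈ Nbar σ i) (hτself : ∀ σ i, τ σ i i = 0)
    (hτ : ∀ σ i j, τ σ i j ≤ h)
    (hrec : ∀ σ i j, E j i → ∃ σ' ∈ Finset.Icc σ (σ + h), j ∈ Nbar σ' i)
    {i : N} (hi : Relation.ReflTransGen E r i) :
    ∃ K : ℕ, ∀ x : ℕ → N → ℝ, IsDelayedAverage Nbar τ x → ∀ (a : ℝ) (σ : ℕ),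
      (∀ s, σ ≤ s → ∀ i, a ≤ x s i) → ∀ k, K ≤ k →
        (Fintype.card N : ℝ)⁻¹ ^ k * (x (σ + h) r - a) ≤ x (σ + h + k) i - a := by
  have hα : (0 : ℝ) ≤ (Fintype.card N : ℝ)⁻¹ := by positivity
  have hα1 : (Fintype.card N : ℝ)⁻¹ ≤ 1 :=
    inv_le_one_of_one_le₀ (by exact_mod_cast Fintype.card_pos)
  set α := (Fintype.card N : ℝ)⁻¹
  have hstep : ∀ x : ℕ → N → ℝ, IsDelayedAverage Nbar τ x → ∀ (a : ℝ) (σ : ℕ),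
      (∀ s, σ ≤ s → ∀ i, a ≤ x s i) → ∀ k i j, j ∈ Nbar (σ + h + k) i →
        α * (x (σ + h + k - τ (σ + h + k) i j) j - a) ≤ x (σ + h + (k + 1)) i - a := by
    intro x hx a σ ha k i j hj
    refine hx.inv_card_mul_sub_le (fun l _ => ha _ ?_ l) hj
    have := hτ (σ + h + k) i l
    omega
  have hpersist : ∀ x : ℕ → N → ℝ, IsDelayedAverage Nbar τ x → ∀ (a : ℝ) (σ : ℕ),
      (∀ s, σ ≤ s → ∀ i, a ≤ x s i) → ∀ (c : ℝ) (i : N) (K : ℕ),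
        α ^ K * c ≤ x (σ + h + K) i - a →
          ∀ k, K ≤ k → α ^ k * c ≤ x (σ + h + k) i - a := by
    intro x hx a σ ha c i K hK k hk
    induction k, hk using Nat.le_induction with
    | base => exact hK
    | succ k _ ih =>
      have h1 := hstep x hx a σ ha k i i (hmem _ _)
      rw [hτself, Nat.sub_zero] at h1
      have h2 := mul_le_mul_of_nonneg_left ih hα
      rw [pow_succ']
      linarith
  induction hi with
  | refl => exact ⟨0, fun x hx a σ ha => hpersist x hx a σ ha _ _ 0 (by simp)⟩
  | @tail j i _ hji ih =>
    obtain ⟨K, hK⟩ := ih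
    refine ⟨K + 2 * h + 1, fun x hx a σ ha k hk => ?_⟩
    obtain ⟨t, ht, hjt⟩ := hrec (σ + h + (K + h)) i j hji
    rw [Finset.mem_Icc] at ht
    obtain ⟨l, rfl⟩ : ∃ l, t = σ + h + l := ⟨t - (σ + h), by omega⟩
    have hd := hτ (σ + h + l) i j
    refine hpersist x hx a σ ha _ i (l + 1) ?_ k (by omega)
    have h1 := hstep x hx a σ ha l i j hjt
    obtain ⟨p, hp⟩ : ∃ p, σ + h + l - τ (σ + h + l) i j = σ + h + p :=
      ⟨l - τ (σ + h + l) i j, by omega⟩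
    rw [hp] at h1
    have h2 := hK x hx a σ ha p (by omega)
    have h3 : 0 ≤ x (σ + h) r - a := sub_nonneg.2 (ha _ (by omega) r)
    have h4 : α ^ l * (x (σ + h) r - a) ≤ α ^ p * (x (σ + h) r - a) :=
      mul_le_mul_of_nonneg_right (pow_le_pow_of_le_one hα hα1 (by omega)) h3
    have h5 := mul_le_mul_of_nonneg_left (h4.trans h2) hα
    rw [pow_succ', mul_assoc]
    exact h5.trans h1

/-- A lower bound `a` improves, after a bounded time, by a fixed fraction of the gap between `a`
and the value at the root. -/
lemma exists_improved_lower_bound (hmem : ∀ σ i, i ∈ Nbar σ i) (hτself : ∀ σ i, τ σ i i = 0)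
    (hτ : ∀ σ i j, τ σ i j ≤ h)
    (hrec : ∀ σ i j, E j i → ∃ σ' ∈ Finset.Icc σ (σ + h), j ∈ Nbar σ' i)
    (hrooted : ∀ i, Relation.ReflTransGen E r i) :
    ∃ (K : ℕ) (ε : ℝ), 0 < ε ∧ ε ≤ 1 ∧ ∀ x : ℕ → N → ℝ, IsDelayedAverage Nbar τ x →
      ∀ (a : ℝ) (σ : ℕ), (∀ s, σ ≤ s → ∀ i, a ≤ x s i) →
        ∀ s, σ + K ≤ s → ∀ i, a + ε * (x (σ + h) r - a) ≤ x s i := by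
  choose K hK using fun i => exists_delay_root_influence hmem hτself hτ hrec (hrooted i)
  have hcard : (0 : ℝ) < Fintype.card N := by exact_mod_cast Fintype.card_pos
  have hα1 : (Fintype.card N : ℝ)⁻¹ ≤ 1 :=
    inv_le_one_of_one_le₀ (by exact_mod_cast Fintype.card_pos)
  have hα : (0 : ℝ) < (Fintype.card N : ℝ)⁻¹ := inv_pos.2 hcard
  set L := Finset.univ.sup K
  refine ⟨h + L, (Fintype.card N : ℝ)⁻¹ ^ (L + h), by positivity, pow_le_one₀ hα.le hα1, ?_⟩
  intro x hx a σ ha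
  refine hx.le_of_le_on_window hmem hτ fun s hs hs' i => ?_
  obtain ⟨k, rfl⟩ : ∃ k, s = σ + h + k := ⟨s - (σ + h), by omega⟩
  have hKi : K i ≤ L := Finset.le_sup (Finset.mem_univ i)
  have h1 := hK i x hx a σ ha k (by omega)
  have h2 : 0 ≤ x (σ + h) r - a := sub_nonneg.2 (ha _ (by omega) r)
  have h3 := mul_le_mul_of_nonneg_right
    (pow_le_pow_of_le_one hα.le hα1 (show k ≤ L + h by omega)) h2
  linarith

/-- Delayed averaging over a recurrently connected rooted graph reaches consensus. -/
theorem exists_tendsto (hx : IsDelayedAverage Nbar τ x) (hmem : ∀ σ i, i ∈ Nbar σ i)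
    (hτself : ∀ σ i, τ σ i i = 0) (hτ : ∀ σ i j, τ σ i j ≤ h)
    (hrec : ∀ σ i j, E j i → ∃ σ' ∈ Finset.Icc σ (σ + h), j ∈ Nbar σ' i)
    (hrooted : ∀ i, Relation.ReflTransGen E r i) :
    ∃ c : ℝ, ∀ i, Tendsto (fun σ => x σ i) atTop (nhds c) := by
  obtain ⟨K, ε, hε, hε1, himp⟩ := exists_improved_lower_bound hmem hτself hτ hrec hrooted
  have hbelow : ∀ y : ℕ → N → ℝ, IsDelayedAverage Nbar τ y → ∃ a, ∀ s i, a ≤ y s i := by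
    intro y hy
    obtain ⟨a, ha⟩ := (Set.finite_range fun p : Fin (h + 1) × N => y p.1 p.2).bddBelow
    refine ⟨a, fun s => hy.le_of_le_on_window hmem hτ (σ := 0) (fun s _ hs i => ?_) s s.zero_le⟩
    exact ha ⟨(⟨s, by omega⟩, i), rfl⟩
  obtain ⟨a₀, ha₀⟩ := hbelow x hx
  obtain ⟨b₀, hb₀⟩ := hbelow _ hx.neg
  have hcontract : ∀ p : ℕ, ∃ (σ : ℕ) (a b : ℝ), b - a = (1 - ε) ^ p * (-b₀ - a₀) ∧
      ∀ s, σ ≤ s → ∀ i, a ≤ x s i ∧ x s i ≤ b := by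
    intro p
    induction p with
    | zero => exact ⟨0, a₀, -b₀, by simp, fun s _ i => ⟨ha₀ s i, le_neg.1 (hb₀ s i)⟩⟩
    | succ p ih =>
      obtain ⟨σ, a, b, hab, hbd⟩ := ih
      refine ⟨σ + K, a + ε * (x (σ + h) r - a), b - ε * (b - x (σ + h) r), ?_,
        fun s hs i => ⟨?_, ?_⟩⟩
      · rw [pow_succ', mul_assoc, ← hab]
        ring
      · exact himp x hx a σ (fun s hs i => (hbd s hs i).1) s hs i
      · have := himp _ hx.neg (-b) σ (fun s hs i => neg_le_neg (hbd s hs i).2) s hs i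
        linarith
  have hosc : ∀ δ > 0, ∃ σ : ℕ, ∀ s ≥ σ, ∀ t ≥ σ, ∀ i j, dist (x s i) (x t j) < δ := by
    intro δ hδ
    have hlim : Tendsto (fun p : ℕ => (1 - ε) ^ p * (-b₀ - a₀)) atTop (nhds 0) := by
      simpa using (tendsto_pow_atTop_nhds_zero_of_lt_one (sub_nonneg.2 hε1)
        (sub_lt_self 1 hε)).mul_const (-b₀ - a₀)
    obtain ⟨p, hp⟩ := (hlim.eventually_lt_const hδ).exists
    obtain ⟨σ, a, b, hab, hbd⟩ := hcontract p
    refine ⟨σ, fun s hs t ht i j => ?_⟩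
    have h1 := hbd s hs i
    have h2 := hbd t ht j
    rw [Real.dist_eq, abs_lt]
    constructor <;> linarith
  have hcauchy : CauchySeq fun s => x s r := Metric.cauchySeq_iff.2 fun δ hδ => by
    obtain ⟨σ, hσ⟩ := hosc δ hδ
    exact ⟨σ, fun s hs t ht => hσ s hs t ht r r⟩
  obtain ⟨c, hc⟩ := cauchySeq_tendsto_of_complete hcauchy
  refine ⟨c, fun i => (tendsto_iff_of_dist ?_).1 hc⟩
  refine Metric.tendsto_atTop.2 fun δ hδ => ?_
  obtain ⟨σ, hσ⟩ := hosc δ hδ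
  refine ⟨σ, fun s hs => ?_⟩
  simpa using hσ s hs s hs r i

end IsDelayedAverage

/-- Delayed intermittent averaging without leaders (Proposition 1, leaderless
case): every agent averages the most recent delayed estimates of its
neighbors; if the interconnection graph is rooted and every edge delivers new
information at least once every `h* + 1` sampling instants, then all estimates
converge to a common value `v_c`. -/
theorem delayed_intermittent_averaging_leaderless
    {N : Type*} [Fintype N] [DecidableEq N] [Nonempty N]
    (m : ℕ) (hm : 1 ≤ m)
    (hstar : ℕ)
    (E : N → N → Prop)
    (hself : ∀ i, E i i)
    (r : N)
    (hrooted : ∀ i, Relation.ReflTransGen E r i)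
    (Nbar : ℕ → N → Finset N)
    (hmem : ∀ σ i, i ∈ Nbar σ i)
    (hsub : ∀ σ i, ∀ j ∈ Nbar σ i, E j i)
    (τ : ℕ → N → N → ℕ)
    (hτself : ∀ σ i, τ σ i i = 0)
    (hτle : ∀ σ i j, τ σ i j ≤ min σ hstar)
    (vhat : ℕ → N → EuclideanSpace ℝ (Fin m))
    (hupdate : ∀ σ : ℕ, ∀ i,
      vhat (σ + 1) i =
        ((Nbar σ i).card : ℝ)⁻¹ • ∑ j ∈ Nbar σ i, vhat (σ - τ σ i j) j)
    (hrec : ∀ σ : ℕ, ∀ i j, E j i →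
      ∃ σ' ∈ Finset.Icc σ (σ + hstar), j ∈ Nbar σ' i) :
    ∃ vc : EuclideanSpace ℝ (Fin m),
      ∀ i, Tendsto (fun σ => vhat σ i) atTop (nhds vc) := by
  have hcoord : ∀ l : Fin m, IsDelayedAverage Nbar τ fun s i => vhat s i l := by
    intro l σ i
    simp [hupdate σ i]
  choose c hc using fun l => (hcoord l).exists_tendsto hmem hτself
    (fun σ i j => (hτle σ i j).trans (min_le_right _ _)) hrec hrooted
  refine ⟨WithLp.toLp 2 c, fun i => ?_⟩
  exact ((PiLp.continuous_toLp 2 _).tendsto c).comp (tendsto_pi_nhds.2 fun l => hc l i)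
end

section
/- A window of reflexive graphs covering a rooted graph has rooted composition (key claim in the proof of Proposition 1): Let N be a finite set and let G_0, G_1, …, G_q be reflexive relations on N (directed graphs each containing a self-loop at every node). Let E be a relation on N that is rooted at some r ∈ N, and suppose that every edge of E is an edge of at least one of the graphs G_0, …, G_q. Then the composition G_q ∘ G_{q−1} ∘ ⋯ ∘ G_0 is rooted at r. -/
/-- Composition of two directed graphs (edge relations) on the same vertex set:
`graphCompRel E1 E2 j i` holds iff there is `l` with `E2 j l` and `E1 l i`. -/
def graphCompRel {N : Type*} (E1 E2 : N → N → Prop) : N → N → Prop :=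
  fun j i => ∃ l, E2 j l ∧ E1 l i

/-- Iterated composition `G_q ∘ G_{q-1} ∘ ⋯ ∘ G_0`. -/
def graphCompSeq {N : Type*} (G : ℕ → N → N → Prop) : ℕ → (N → N → Prop)
  | 0 => G 0
  | (k + 1) => graphCompRel (G (k + 1)) (graphCompSeq G k)

theorem graphCompSeq_refl {N : Type*} (G : ℕ → N → N → Prop) (q : ℕ)
    (hrefl : ∀ k ≤ q, ∀ i, G k i i) (i : N) : graphCompSeq G q i i := by
  induction q with
  | zero => exact hrefl 0 le_rfl i
  | succ q ih =>
    exact ⟨i, ih fun k hk => hrefl k (Nat.le_succ_of_le hk), hrefl (q + 1) le_rfl i⟩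

/-- Every edge of a graph in a window of reflexive graphs is an edge of the composition. -/
theorem graphCompSeq_of_edge {N : Type*} (G : ℕ → N → N → Prop) (q : ℕ)
    (hrefl : ∀ k ≤ q, ∀ i, G k i i) {k : ℕ} (hk : k ≤ q) {j i : N} (h : G k j i) :
    graphCompSeq G q j i := by
  induction q with
  | zero =>
    obtain rfl := Nat.le_zero.mp hk
    exact h
  | succ q ih =>
    have hrefl' : ∀ k ≤ q, ∀ i, G k i i := fun k hk => hrefl k (Nat.le_succ_of_le hk)
    rcases Nat.le_succ_iff.mp hk with hk' | rfl
    · exact ⟨i, ih hrefl' hk', hrefl (q + 1) le_rfl i⟩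
    · exact ⟨j, graphCompSeq_refl G q hrefl' j, h⟩

/-- A window of reflexive graphs covering a rooted graph has rooted composition:
if each `G_0, …, G_q` is reflexive, `E` is rooted at `r`, and every edge of `E`
is an edge of some `G_k` (`k ≤ q`), then `G_q ∘ ⋯ ∘ G_0` is rooted at `r`. -/
theorem composition_of_covering_reflexive_graphs_rooted
    {N : Type*} [Finite N]
    (G : ℕ → N → N → Prop) (q : ℕ)
    (hrefl : ∀ k ≤ q, ∀ i, G k i i)
    (E : N → N → Prop) (r : N)
    (hrooted : ∀ i, Relation.ReflTransGen E r i)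
    (hcover : ∀ j i, E j i → ∃ k ≤ q, G k j i) :
    ∀ i, Relation.ReflTransGen (graphCompSeq G q) r i := by
  intro i
  refine Relation.ReflTransGen.mono (fun j i h => ?_) _ _ (hrooted i)
  obtain ⟨k, hk, hG⟩ := hcover j i h
  exact graphCompSeq_of_edge G q hrefl hk hG
end

section
/- Rootedness of the modified interaction graph (appendix of Proposition 1): Let N be a finite set, E an edge relation on N, L ⊆ N a nonempty set of leaders, and r ∈ L such that E is rooted at r. Define the relation E_s on N by: E_s j i holds if and only if (j = i), or (i ∈ L and j ∈ L), or (i ∉ L and E j i). (That is, E_s is obtained from E by removing all incoming edges of every leader node, adding a directed edge from every leader to every other leader, and adding a self-loop at every node.) Then E_s is rooted at r. -/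
/-- Rootedness of the modified interaction graph: if `E` is rooted at a leader
`r ∈ L`, then the relation `E_s` — obtained from `E` by removing all incoming
edges of leader nodes, adding an edge from every leader to every other leader,
and adding a self-loop at every node — is also rooted at `r`. -/
theorem modified_interaction_graph_rooted
    {N : Type*} [Finite N]
    (E : N → N → Prop) (L : Set N) (hL : L.Nonempty)
    (r : N) (hr : r ∈ L)
    (hrooted : ∀ i, Relation.ReflTransGen E r i)
    (Es : N → N → Prop)
    (hEs : ∀ j i, Es j i ↔ (j = i ∨ (i ∈ L ∧ j ∈ L) ∨ (i ∉ L ∧ E j i))) :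
    ∀ i, Relation.ReflTransGen Es r i := by
  intro i
  induction hrooted i with
  | refl => exact .refl
  | @tail j k _ hjk ih =>
    by_cases hk : k ∈ L
    · exact .single ((hEs r k).2 (.inr (.inl ⟨hk, hr⟩)))
    · exact ih.tail ((hEs j k).2 (.inr (.inr ⟨hk, hjk⟩)))
end

section
/- Bound on the information age under Assumption 1: Let T > 0, h ≥ 0, let k* ≥ 1 be an integer, and let τ : ℕ → [0, ∞] be a sequence of delays. Suppose there exists a strictly increasing sequence (κ_l)_{l ∈ ℕ} of natural numbers with κ_0 ≤ k*, κ_{l+1} − κ_l ≤ k* for all l, and τ_{κ_l} ≤ h for all l. Then for every real t ≥ k*·T + h, the set {k ∈ ℕ : k·T + τ_k ≤ t} is nonempty and bounded above, and its maximum K(t) satisfies t − K(t)·T ≤ k*·T + h. -/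
open scoped ENNReal

/-- Bound on the information age under Assumption 1: if among the messages
stamped `k` (sent at time `k·T`, delivered with delay `τ k ∈ [0,∞]`) there is
a subsequence `κ_l` with `κ_0 ≤ k*`, `κ_{l+1} − κ_l ≤ k*` and `τ (κ l) ≤ h`,
then for every `t ≥ k*·T + h` the set of stamps already delivered at time `t`
is nonempty and bounded above, and its maximum `K(t)` satisfies
`t − K(t)·T ≤ k*·T + h`. -/
theorem information_age_bound
    (T h : ℝ) (hT : 0 < T) (hh : 0 ≤ h)
    (kstar : ℕ) (hkstar : 1 ≤ kstar)
    (τ : ℕ → ℝ≥0∞)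
    (κ : ℕ → ℕ) (hκmono : StrictMono κ) (hκ0 : κ 0 ≤ kstar)
    (hκstep : ∀ l, κ (l + 1) - κ l ≤ kstar)
    (hτκ : ∀ l, τ (κ l) ≤ ENNReal.ofReal h) :
    ∀ t : ℝ, (kstar : ℝ) * T + h ≤ t →
      ({k : ℕ | τ k ≠ ⊤ ∧ (k : ℝ) * T + (τ k).toReal ≤ t}).Nonempty ∧
      BddAbove {k : ℕ | τ k ≠ ⊤ ∧ (k : ℝ) * T + (τ k).toReal ≤ t} ∧
      t - (sSup {k : ℕ | τ k ≠ ⊤ ∧ (k : ℝ) * T + (τ k).toReal ≤ t} : ℕ) * T ≤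
        (kstar : ℝ) * T + h := by
  intro t ht
  set S := {k : ℕ | τ k ≠ ⊤ ∧ (k : ℝ) * T + (τ k).toReal ≤ t}
  have mem_of_le : ∀ l, (κ l : ℝ) * T + h ≤ t → κ l ∈ S := fun l hl =>
    ⟨ne_top_of_le_ne_top ENNReal.ofReal_ne_top (hτκ l), by
      linarith [ENNReal.toReal_le_of_le_ofReal hh (hτκ l)]⟩
  have mem_zero : κ 0 ∈ S := by
    refine mem_of_le 0 (le_trans ?_ ht)
    gcongr
  have bdd : BddAbove S := by
    refine ⟨⌊t / T⌋₊, fun k hk => Nat.le_floor ?_⟩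
    rw [le_div_iff₀ hT]
    linarith [hk.2, ENNReal.toReal_nonneg (a := τ k)]
  refine ⟨⟨_, mem_zero⟩, bdd, ?_⟩
  by_contra! hlt
  have mem_all : ∀ l, κ l ∈ S := by
    intro l
    induction l with
    | zero => exact mem_zero
    | succ l ih =>
      apply mem_of_le
      have hle : κ (l + 1) ≤ sSup S + kstar := by
        have := le_csSup bdd ih
        have := hκstep l
        omega
      have hle' : (κ (l + 1) : ℝ) * T ≤ ((sSup S : ℕ) + kstar : ℝ) * T := by
        gcongr
        exact_mod_cast hle
      linarith
  have := le_csSup bdd (mem_all (sSup S + 1))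
  have := hκmono.le_apply (x := sSup S + 1)
  omega
end

section
/- Kernel of the Laplacian of a rooted weighted digraph: Let n ≥ 1 and let a_{ij} ≥ 0 (1 ≤ i, j ≤ n) with a_{ii} = 0 be adjacency weights. Define the Laplacian matrix L ∈ ℝ^{n×n} by L_{ii} = Σ_{j=1}^n a_{ij} and L_{ij} = −a_{ij} for j ≠ i. Suppose the directed graph with edge relation E, where E j i holds if and only if a_{ij} > 0, is rooted at some r (i.e., contains a directed spanning tree). Then every x ∈ ℝ^n with L·x = 0 has all components equal: x_i = x_j for all i, j. -/
/-- Maximum principle: a function harmonic for nonnegative weights `a` attains its maximum at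
every root of the graph with an edge from `j` to `i` whenever `a i j > 0`. -/
theorem le_root_of_weighted_harmonic {ι : Type*} [Fintype ι] {a : ι → ι → ℝ}
    (ha : ∀ i j, 0 ≤ a i j) {r : ι}
    (hrooted : ∀ i, Relation.ReflTransGen (fun j i => 0 < a i j) r i)
    {x : ι → ℝ} (hx : ∀ i, ∑ j, a i j * (x i - x j) = 0) (i : ι) : x i ≤ x r := by
  have : Nonempty ι := ⟨r⟩
  obtain ⟨m, hm⟩ := Finite.exists_max x
  have max_root (m : ι) (hm : ∀ k, x k ≤ x m) : ∀ k, x k ≤ x r := by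
    induction hrooted m with
    | refl => exact hm
    | @tail b c _ hbc ih =>
      have hzero : a c b * (x c - x b) = 0 :=
        (Finset.sum_eq_zero_iff_of_nonneg fun j _ =>
          mul_nonneg (ha c j) (sub_nonneg.mpr (hm j))).mp (hx c) b (Finset.mem_univ b)
      have hcb : x c = x b := sub_eq_zero.mp ((mul_eq_zero.mp hzero).resolve_left hbc.ne')
      exact ih fun k => hcb ▸ hm k
  exact max_root m hm i


/-- Kernel of the Laplacian of a rooted weighted digraph: if the directed graph
with an edge from `j` to `i` whenever `a i j > 0` is rooted at some `r`, then
every vector in the kernel of the Laplacian `L` (with `L i i = ∑ j, a i j` and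
`L i j = -(a i j)` for `j ≠ i`) has all its components equal. -/
theorem laplacian_kernel_of_rooted_graph
    (n : ℕ) (hn : 1 ≤ n)
    (a : Fin n → Fin n → ℝ)
    (ha : ∀ i j, 0 ≤ a i j) (hdiag : ∀ i, a i i = 0)
    (L : Matrix (Fin n) (Fin n) ℝ)
    (hL : ∀ i j, L i j = if i = j then ∑ k, a i k else -(a i j))
    (r : Fin n)
    (hrooted : ∀ i, Relation.ReflTransGen (fun j i => 0 < a i j) r i)
    (x : Fin n → ℝ) (hx : L.mulVec x = 0) :
    ∀ i j, x i = x j := by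
  have hharm (i : Fin n) : ∑ j, a i j * (x i - x j) = 0 := by
    have hLx : ∑ j, L i j * x j = 0 := congrFun hx i
    have hterm (j : Fin n) :
        L i j * x j = (if i = j then (∑ k, a i k) * x i else 0) - a i j * x j := by
      rw [hL]
      split_ifs with hij
      · subst hij
        simp [hdiag]
      · ring
    simp only [hterm, Finset.sum_sub_distrib, Finset.sum_ite_eq, Finset.mem_univ, if_true] at hLx
    simpa only [mul_sub, Finset.sum_sub_distrib, ← Finset.sum_mul] using hLx
  have hharm_neg (i : Fin n) : ∑ j, a i j * ((-x) i - (-x) j) = 0 := by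
    rw [← neg_eq_zero, ← Finset.sum_neg_distrib, ← hharm i]
    refine Finset.sum_congr rfl fun j _ => ?_
    simp only [Pi.neg_apply]
    ring
  have hroot (i : Fin n) : x i = x r :=
    le_antisymm (le_root_of_weighted_harmonic ha hrooted hharm i)
      (neg_le_neg_iff.mp (le_root_of_weighted_harmonic ha hrooted hharm_neg i))
  exact fun i j => (hroot i).trans (hroot j).symm
end

section
/- Asymptotic position synchronization from a vanishing Laplacian image (final step of the proof of Theorem 2): Let n ≥ 1 and let a_{ij} ≥ 0 (1 ≤ i, j ≤ n) with a_{ii} = 0 be adjacency weights, and let L ∈ ℝ^{n×n} be the Laplacian with L_{ii} = Σ_{j=1}^n a_{ij} and L_{ij} = −a_{ij} for j ≠ i. Suppose the directed graph with edge relation E, where E j i holds if and only if a_{ij} > 0, is rooted at some r. If p : ℝ → ℝ^n is any function with L·p(t) → 0 as t → ∞, then p_i(t) − p_j(t) → 0 as t → ∞ for all i, j. -/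
open Filter

/-- Maximum principle: a function whose weighted differences to its in-neighbours sum to zero at
every node attains its maximum at every root. -/
theorem le_root_of_sum_weighted_diff_eq_zero {ι : Type*} [Fintype ι] {a : ι → ι → ℝ}
    (ha : ∀ i j, 0 ≤ a i j) {r : ι}
    (hrooted : ∀ i, Relation.ReflTransGen (fun j i => 0 < a i j) r i)
    {x : ι → ℝ} (hx : ∀ i, ∑ k, a i k * (x i - x k) = 0) (i : ι) : x i ≤ x r := by
  have : Nonempty ι := ⟨r⟩
  obtain ⟨m, hm⟩ := Finite.exists_max x
  suffices h : x r = x m from h ▸ hm i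
  have hpath := hrooted m
  clear hrooted
  induction hpath using Relation.ReflTransGen.head_induction_on with
  | refl => rfl
  | @head j k hjk _ ih =>
    have hterm := (Finset.sum_eq_zero_iff_of_nonneg fun l _ =>
      mul_nonneg (ha k l) (sub_nonneg.2 (ih ▸ hm l))).1 (hx k) j (Finset.mem_univ j)
    rcases mul_eq_zero.1 hterm with h | h
    · exact absurd h hjk.ne'
    · linarith

/-- Functions with vanishing weighted differences on a rooted graph are constant. -/
theorem eq_root_of_sum_weighted_diff_eq_zero {ι : Type*} [Fintype ι] {a : ι → ι → ℝ}
    (ha : ∀ i j, 0 ≤ a i j) {r : ι}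
    (hrooted : ∀ i, Relation.ReflTransGen (fun j i => 0 < a i j) r i)
    {x : ι → ℝ} (hx : ∀ i, ∑ k, a i k * (x i - x k) = 0) (i : ι) : x i = x r := by
  refine le_antisymm (le_root_of_sum_weighted_diff_eq_zero ha hrooted hx i)
    (neg_le_neg_iff.1 (le_root_of_sum_weighted_diff_eq_zero (x := fun k => -x k) ha hrooted
      (fun l => ?_) i))
  rw [← neg_eq_zero, ← hx l, ← Finset.sum_neg_distrib]
  exact Finset.sum_congr rfl fun k _ => by ring

theorem laplacian_mulVec_apply {ι : Type*} [Fintype ι] [DecidableEq ι] {a : ι → ι → ℝ}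
    (hdiag : ∀ i, a i i = 0) {L : Matrix ι ι ℝ}
    (hL : ∀ i j, L i j = if i = j then ∑ k, a i k else -(a i j)) (x : ι → ℝ) (i : ι) :
    L.mulVec x i = ∑ k, a i k * (x i - x k) := by
  have hentry (k : ι) : L i k = (if i = k then ∑ l, a i l else 0) - a i k := by
    rw [hL]
    split_ifs with h
    · rw [← h, hdiag, sub_zero]
    · ring
  simp [Matrix.mulVec, dotProduct, hentry, sub_mul, mul_sub, Finset.sum_mul]

/-- A linear functional vanishing on the kernel of a linear map `A` tends to zero along any family
whose image under `A` does. -/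
theorem LinearMap.tendsto_zero_of_ker_le {ι E F : Type*} [AddCommGroup E] [Module ℝ E]
    [NormedAddCommGroup F] [NormedSpace ℝ F] [FiniteDimensional ℝ F]
    (A : E →ₗ[ℝ] F) (g : E →ₗ[ℝ] ℝ) (hg : LinearMap.ker A ≤ LinearMap.ker g)
    {l : Filter ι} {p : ι → E} (hp : Tendsto (fun t => A (p t)) l (nhds 0)) :
    Tendsto (fun t => g (p t)) l (nhds 0) := by
  have hmem : g ∈ LinearMap.range A.dualMap := by
    rw [LinearMap.range_dualMap_eq_dualAnnihilator_ker, Submodule.mem_dualAnnihilator]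
    exact fun x hx => hg hx
  obtain ⟨f, rfl⟩ := hmem
  simpa [Function.comp_def] using (f.continuous_of_finiteDimensional.tendsto 0).comp hp

/-- Asymptotic position synchronization from a vanishing Laplacian image: if
the weighted directed graph (edge from `j` to `i` whenever `a i j > 0`) is
rooted and `L` is its Laplacian, then `L · p(t) → 0` as `t → ∞` implies
`p_i(t) − p_j(t) → 0` for all `i, j`. -/
theorem sync_of_vanishing_laplacian_image
    (n : ℕ) (hn : 1 ≤ n)
    (a : Fin n → Fin n → ℝ)
    (ha : ∀ i j, 0 ≤ a i j) (hdiag : ∀ i, a i i = 0)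
    (L : Matrix (Fin n) (Fin n) ℝ)
    (hL : ∀ i j, L i j = if i = j then ∑ k, a i k else -(a i j))
    (r : Fin n)
    (hrooted : ∀ i, Relation.ReflTransGen (fun j i => 0 < a i j) r i)
    (p : ℝ → Fin n → ℝ)
    (hp : Tendsto (fun t => L.mulVec (p t)) atTop (nhds 0)) :
    ∀ i j, Tendsto (fun t => p t i - p t j) atTop (nhds 0) := by
  intro i j
  refine LinearMap.tendsto_zero_of_ker_le L.mulVecLin
    (LinearMap.proj (R := ℝ) (φ := fun _ : Fin n => ℝ) i - LinearMap.proj j) (fun x hx => ?_) hp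
  have hx' (k : Fin n) : ∑ l, a k l * (x k - x l) = 0 := by
    rw [← laplacian_mulVec_apply hdiag hL]
    exact congrFun hx k
  have hconst := eq_root_of_sum_weighted_diff_eq_zero ha hrooted hx'
  simp [hconst i, hconst j]
end

section
/- Recurrent arrival of new information under Assumption 1 (used in the appendix proof of Proposition 1): Let T > 0, h ≥ 0, let k* ≥ 1 be an integer, and let τ : ℕ → [0, ∞] be a sequence of delays. Suppose there exists a strictly increasing sequence (κ_l)_{l ∈ ℕ} of natural numbers with κ_0 ≤ k*, κ_{l+1} − κ_l ≤ k* for all l, and τ_{κ_l} ≤ h for all l. Define K : ℝ → ℤ by K(t) = max{k ∈ ℕ : k·T + τ_k ≤ t} if this set is nonempty, and K(t) = −1 otherwise. Let h*_σ := ⌈(k*·T + h)/T⌉. Then for every ρ ∈ ℕ there exists σ ∈ {ρ+1, ρ+2, …, ρ + h*_σ} such that K(σ·T) > K((σ−1)·T). -/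
open scoped ENNReal

/-- A sequence of naturals that starts at most at `d`, is strictly increasing and has gaps at most
`d` meets every window `{n + 1, …, n + d}`. -/
theorem StrictMono.exists_mem_Ioc_of_gap_le {κ : ℕ → ℕ} (hκ : StrictMono κ) {d : ℕ}
    (h0 : κ 0 ≤ d) (hstep : ∀ l, κ (l + 1) - κ l ≤ d) (n : ℕ) :
    ∃ l, κ l ∈ Set.Ioc n (n + d) := by
  have hex : ∃ l, n < κ l := ⟨n + 1, hκ.le_apply⟩
  refine ⟨Nat.find hex, Nat.find_spec hex, ?_⟩
  rcases hl : Nat.find hex with _ | l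
  · omega
  · have hle : κ l ≤ n := not_lt.mp (Nat.find_min hex (by omega))
    have := hstep l
    omega

/-- A sequence that ends a window above its initial value increases at some step
inside the window. -/
theorem exists_mem_Icc_lt_of_lt {f : ℕ → ℤ} {n m : ℕ} (h : f n < f (n + m)) :
    ∃ σ ∈ Finset.Icc (n + 1) (n + m), f (σ - 1) < f σ := by
  by_contra! hno
  have hle : ∀ j ≤ m, f (n + j) ≤ f n := by
    intro j
    induction j with
    | zero => simp
    | succ j ih =>
      intro hj
      have hstep := hno (n + (j + 1)) (Finset.mem_Icc.mpr ⟨by omega, by omega⟩)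
      exact hstep.trans (ih (by omega))
  exact (hle m le_rfl).not_gt h

/-- A message cannot be delivered before it is sent. -/
theorem le_of_delivered {T : ℝ} (hT : 0 < T) {τ : ℕ → ℝ≥0∞} {k n : ℕ}
    (hk : (k : ℝ) * T + (τ k).toReal ≤ (n : ℝ) * T) : k ≤ n := by
  have h : (k : ℝ) * T ≤ (n : ℝ) * T := by
    linarith [ENNReal.toReal_nonneg (a := τ k)]
  exact_mod_cast le_of_mul_le_mul_right h hT

/-- Recurrent arrival of new information under Assumption 1: with `K(t)` the
largest stamp `k` of a message (sent at `k·T`, delay `τ k ∈ [0,∞]`) already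
delivered at time `t` (and `K(t) = -1` if no message has been delivered), in
every window `{ρ+1, …, ρ + ⌈(k*·T + h)/T⌉}` of sampling instants there is a
`σ` at which strictly newer information has been received:
`K(σT) > K((σ−1)T)`. -/
theorem recurrent_arrival_of_new_information
    (T h : ℝ) (hT : 0 < T) (hh : 0 ≤ h)
    (kstar : ℕ) (hkstar : 1 ≤ kstar)
    (τ : ℕ → ℝ≥0∞)
    (κ : ℕ → ℕ) (hκmono : StrictMono κ) (hκ0 : κ 0 ≤ kstar)
    (hκstep : ∀ l, κ (l + 1) - κ l ≤ kstar)
    (hτκ : ∀ l, τ (κ l) ≤ ENNReal.ofReal h)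
    (K : ℝ → ℤ)
    (hK_pos : ∀ t : ℝ,
      ({k : ℕ | τ k ≠ ⊤ ∧ (k : ℝ) * T + (τ k).toReal ≤ t}).Nonempty →
      K t = (sSup {k : ℕ | τ k ≠ ⊤ ∧ (k : ℝ) * T + (τ k).toReal ≤ t} : ℕ))
    (hK_neg : ∀ t : ℝ,
      ¬ ({k : ℕ | τ k ≠ ⊤ ∧ (k : ℝ) * T + (τ k).toReal ≤ t}).Nonempty →
      K t = -1) :
    ∀ ρ : ℕ, ∃ σ ∈ Finset.Icc (ρ + 1) (ρ + ⌈((kstar : ℝ) * T + h) / T⌉₊),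
      K ((σ : ℝ) * T) > K (((σ - 1 : ℕ) : ℝ) * T) := by
  intro ρ
  set H := ⌈((kstar : ℝ) * T + h) / T⌉₊
  refine exists_mem_Icc_lt_of_lt (f := fun n : ℕ => K ((n : ℝ) * T)) ?_
  obtain ⟨l, hlρ, hlk⟩ := hκmono.exists_mem_Ioc_of_gap_le hκ0 hκstep ρ
  have hKρ : K ((ρ : ℝ) * T) ≤ ρ := by
    by_cases hne : ({k : ℕ | τ k ≠ ⊤ ∧ (k : ℝ) * T + (τ k).toReal ≤ (ρ : ℝ) * T}).Nonempty
    · rw [hK_pos _ hne]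
      exact_mod_cast csSup_le hne fun k hk => le_of_delivered hT hk.2
    · rw [hK_neg _ hne]
      omega
  have hmem : κ l ∈ {k : ℕ | τ k ≠ ⊤ ∧
      (k : ℝ) * T + (τ k).toReal ≤ ((ρ + H : ℕ) : ℝ) * T} := by
    refine ⟨ne_top_of_le_ne_top ENNReal.ofReal_ne_top (hτκ l), ?_⟩
    have hdelay : (τ (κ l)).toReal ≤ h := ENNReal.toReal_le_of_le_ofReal hh (hτκ l)
    have hceil : (kstar : ℝ) * T + h ≤ H * T := (div_le_iff₀ hT).mp (Nat.le_ceil _)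
    have hstamp : (κ l : ℝ) * T ≤ (ρ + kstar) * T :=
      mul_le_mul_of_nonneg_right (by exact_mod_cast hlk) hT.le
    push_cast
    linarith
  have hκK : (κ l : ℤ) ≤ K (((ρ + H : ℕ) : ℝ) * T) := by
    rw [hK_pos _ ⟨_, hmem⟩]
    exact_mod_cast le_csSup ⟨ρ + H, fun k hk => le_of_delivered hT hk.2⟩ hmem
  change K ((ρ : ℝ) * T) < K (((ρ + H : ℕ) : ℝ) * T)
  omega
end
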